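/- There exist constants C₀ > 1 and c > 0 such that for all n, k ∈ ℕ with n ≥ C₀ and k ≥ (1/2)·(log₂ n)^12, there exists a function IExt : {0,1}^n × {0,1}^{2n} → {0,1}^m with m = ⌊1.8k⌋ such that: for every (n, 2k)-source X and every (2k, 2k) block source Y = (Y₁, Y₂) with each block on {0,1}^n that is independent of X, one has |(IExt(X,Y), Y) − (U_m, Y)| ≤ ε and |(IExt(X,Y), X) − (U_m, X)| ≤ ε, where ε = 2^{−k^c}. -/

import Mathlib

open Finset

abbrev BitStr (n : ℕ) := Fin n → Bool

/-- `p` is a probability distribution on the finite type `α`. -/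
def IsProb {α : Type*} [Fintype α] (p : α → ℝ) : Prop :=
  (∀ a, 0 ≤ p a) ∧ ∑ a, p a = 1

/-- Statistical distance: `max_{T ⊆ α} |p(T) − q(T)|`. -/
noncomputable def statDist {α : Type*} [Fintype α] (p q : α → ℝ) : ℝ :=
  ⨆ T : Finset α, |∑ a ∈ T, p a - ∑ a ∈ T, q a|

/-- `H_∞(p) ≥ k`, i.e. every point has probability at most `2^(-k)`. -/
def IsKSource {α : Type*} [Fintype α] (p : α → ℝ) (k : ℝ) : Prop :=
  ∀ a, p a ≤ (2 : ℝ) ^ (-k)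

/-- The uniform distribution on a finite type. -/
noncomputable def unif (α : Type*) [Fintype α] : α → ℝ := fun _ => (Fintype.card α : ℝ)⁻¹


/-- `Y = (Y₁, Y₂)` is a `(k₁, k₂)` block source. -/
def IsBlockSource2 {β₁ β₂ : Type*} [Fintype β₁] [Fintype β₂]
    (p : β₁ × β₂ → ℝ) (k₁ k₂ : ℝ) : Prop :=
  (∀ y₁, (∑ y₂, p (y₁, y₂)) ≤ (2 : ℝ) ^ (-k₁)) ∧
  (∀ y₁, (∑ y₂, p (y₁, y₂)) ≠ 0 →
      ∀ y₂, p (y₁, y₂) ≤ (2 : ℝ) ^ (-k₂) * ∑ y₂', p (y₁, y₂'))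

noncomputable def hh {V : Type*} [Fintype V] [DecidableEq V] (A : Finset V) (v : V) : ℝ :=
  (if v ∈ A then 1 else 0) - (A.card : ℝ) / Fintype.card V

lemma hh_abs {V : Type*} [Fintype V] [DecidableEq V] (A : Finset V) (v : V) : |hh A v| ≤ 1 := by
  have h1 : (A.card : ℝ) ≤ Fintype.card V := by exact_mod_cast Finset.card_le_univ A
  have h0 : (0 : ℝ) ≤ (A.card : ℝ) / Fintype.card V := by positivity
  have h2 : (A.card : ℝ) / Fintype.card V ≤ 1 := div_le_one_of_le₀ h1 (by positivity)
  unfold hh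
  rw [abs_le]
  split_ifs <;> constructor <;> linarith

lemma hh_sum {V : Type*} [Fintype V] [DecidableEq V] [Nonempty V] (A : Finset V) :
    ∑ v, hh A v = 0 := by
  have : (Fintype.card V : ℝ) ≠ 0 := by exact_mod_cast Fintype.card_ne_zero
  unfold hh
  rw [Finset.sum_sub_distrib]
  simp
  field_simp
  simp

lemma hh_compl {V : Type*} [Fintype V] [DecidableEq V] [Nonempty V] (A : Finset V) (v : V) :
    hh Aᶜ v = - hh A v := by
  have : (Fintype.card V : ℝ) ≠ 0 := by exact_mod_cast Fintype.card_ne_zero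
  have h1 : A.card ≤ Fintype.card V := Finset.card_le_univ A
  unfold hh
  rw [Finset.card_compl, Nat.cast_sub h1, sub_div, div_self this]
  by_cases h : v ∈ A <;> simp [h]

lemma hh_mgf {V : Type*} [Fintype V] [DecidableEq V] [Nonempty V] (A : Finset V) (s : ℝ)
    (h0 : 0 ≤ s) (h1 : s ≤ 1) :
    ∑ v, Real.exp (s * hh A v) ≤ Fintype.card V * Real.exp (s ^ 2) := by
  have key : ∀ v, Real.exp (s * hh A v) ≤ 1 + s * hh A v + s ^ 2 := by
    intro v
    have ha := hh_abs A v
    have hb : |s * hh A v| ≤ 1 := by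
      rw [abs_mul, abs_of_nonneg h0]
      nlinarith [abs_nonneg (hh A v)]
    have hc := (abs_le.1 (Real.abs_exp_sub_one_sub_id_le hb)).2
    have hd : (hh A v) ^ 2 ≤ 1 := by
      rw [← sq_abs]; nlinarith [abs_nonneg (hh A v)]
    nlinarith [sq_nonneg s]
  calc ∑ v, Real.exp (s * hh A v) ≤ ∑ v, (1 + s * hh A v + s ^ 2) :=
        Finset.sum_le_sum fun v _ => key v
    _ = Fintype.card V * (1 + s ^ 2) := by
        rw [Finset.sum_add_distrib, Finset.sum_add_distrib, ← Finset.mul_sum, hh_sum]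
        simp; ring
    _ ≤ _ := by
        gcongr
        linarith [Real.add_one_le_exp (s ^ 2)]

lemma exists_good {Ω V J : Type*} [Fintype Ω] [DecidableEq Ω] [Fintype V] [DecidableEq V]
    [Nonempty V] [Fintype J]
    (P : J → Finset Ω) (A : J → Ω → Finset V) (N : ℝ) (hN : ∀ j, ((P j).card : ℝ) ≤ N)
    (ε : ℝ) (h0 : 0 ≤ ε) (h1 : ε ≤ 1)
    (hJ : (Fintype.card J : ℝ) * Real.exp (-(ε ^ 2 * N / 4)) < 1) :
    ∃ f : Ω → V, ∀ j, ∑ ω ∈ P j, hh (A j ω) (f ω) ≤ ε * N := by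
  classical
  by_contra! hcon
  set s := ε / 2 with hs
  have hM : (0 : ℝ) < Fintype.card V := by exact_mod_cast Fintype.card_pos
  have each : ∀ j, ∑ f : Ω → V, Real.exp (s * ∑ ω ∈ P j, hh (A j ω) (f ω))
      ≤ (Fintype.card V : ℝ) ^ Fintype.card Ω * Real.exp (s ^ 2 * N) := by
    intro j
    have e1 : ∀ f : Ω → V, Real.exp (s * ∑ ω ∈ P j, hh (A j ω) (f ω))
        = ∏ ω, (if ω ∈ P j then Real.exp (s * hh (A j ω) (f ω)) else 1) := by
      intro f
      rw [Finset.mul_sum, Real.exp_sum, Finset.prod_ite_mem, Finset.univ_inter]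
    simp_rw [e1]
    rw [← Fintype.prod_sum (fun ω v => if ω ∈ P j then Real.exp (s * hh (A j ω) v) else 1)]
    calc _ ≤ ∏ ω, ((Fintype.card V : ℝ) * (if ω ∈ P j then Real.exp (s ^ 2) else 1)) := by
          apply Finset.prod_le_prod
          · intro ω _
            apply Finset.sum_nonneg
            intro v _
            split_ifs <;> positivity
          · intro ω _
            split_ifs
            · exact hh_mgf _ s (by positivity) (by linarith)
            · simp
      _ = (Fintype.card V : ℝ) ^ Fintype.card Ω * Real.exp (s ^ 2 * (P j).card) := by
          rw [Finset.prod_mul_distrib, Finset.prod_ite_mem, Finset.univ_inter]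
          simp [← Real.exp_nat_mul, mul_comm]
      _ ≤ _ := by
          gcongr
          exact hN j
  have lower : ∀ f : Ω → V, Real.exp (s * (ε * N)) ≤
      ∑ j, Real.exp (s * ∑ ω ∈ P j, hh (A j ω) (f ω)) := by
    intro f
    obtain ⟨j, hj⟩ := hcon f
    refine le_trans ?_ (Finset.single_le_sum
      (f := fun j => Real.exp (s * ∑ ω ∈ P j, hh (A j ω) (f ω)))
      (fun i _ => (Real.exp_pos _).le) (Finset.mem_univ j))
    apply Real.exp_le_exp.2
    apply mul_le_mul_of_nonneg_left hj.le (by positivity)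
  have tot : (Fintype.card V : ℝ) ^ Fintype.card Ω * Real.exp (s * (ε * N)) ≤
      Fintype.card J * ((Fintype.card V : ℝ) ^ Fintype.card Ω * Real.exp (s ^ 2 * N)) := by
    calc _ = ∑ f : Ω → V, Real.exp (s * (ε * N)) := by simp
      _ ≤ ∑ f : Ω → V, ∑ j, Real.exp (s * ∑ ω ∈ P j, hh (A j ω) (f ω)) :=
          Finset.sum_le_sum fun f _ => lower f
      _ = ∑ j, ∑ f : Ω → V, Real.exp (s * ∑ ω ∈ P j, hh (A j ω) (f ω)) := Finset.sum_comm
      _ ≤ ∑ j : J, _ := Finset.sum_le_sum fun j _ => each j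
      _ = _ := by simp
  have hc : (0 : ℝ) < (Fintype.card V : ℝ) ^ Fintype.card Ω := by positivity
  have t2 : Real.exp (s * (ε * N)) ≤ Fintype.card J * Real.exp (s ^ 2 * N) := by
    rw [mul_left_comm (Fintype.card J : ℝ)] at tot
    exact le_of_mul_le_mul_left tot hc
  have e3 : Real.exp (s ^ 2 * N) = Real.exp (s * (ε * N)) * Real.exp (-(ε ^ 2 * N / 4)) := by
    rw [← Real.exp_add]; congr 1; rw [hs]; ring
  rw [e3] at t2
  nlinarith [Real.exp_pos (s * (ε * N))]

lemma flat_bound {α : Type*} [Fintype α] [DecidableEq α] (p g : α → ℝ) (K : ℕ) (hK : 0 < K)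
    (hp : IsProb p) (hpK : ∀ a, p a ≤ (K : ℝ)⁻¹) :
    ∃ S : Finset α, S.card = K ∧ ∑ a, p a * g a ≤ (K : ℝ)⁻¹ * ∑ a ∈ S, g a := by
  have hK' : (0 : ℝ) < K := by exact_mod_cast hK
  have hcard : K ≤ (Finset.univ : Finset α).card := by
    have : (1 : ℝ) ≤ (Finset.univ : Finset α).card * (K : ℝ)⁻¹ := by
      rw [← hp.2, ← nsmul_eq_mul]
      exact Finset.sum_le_card_nsmul _ _ _ fun a _ => hpK a
    rw [← div_eq_mul_inv, le_div_iff₀ hK'] at this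
    rw [one_mul] at this
    exact_mod_cast this
  obtain ⟨S, hS, hmax⟩ := Finset.exists_max_image
    (Finset.powersetCard K (Finset.univ : Finset α)) (fun S => ∑ a ∈ S, g a)
    (Finset.powersetCard_nonempty.2 hcard)
  have hSc := (Finset.mem_powersetCard.1 hS).2
  refine ⟨S, hSc, ?_⟩
  have hne : S.Nonempty := Finset.card_pos.1 (by omega)
  obtain ⟨b, hb, hbmin⟩ := Finset.exists_min_image S g hne
  have hout : ∀ a, a ∉ S → g a ≤ g b := by
    intro a ha
    have ha' : a ∉ S.erase b := fun h => ha (Finset.mem_of_mem_erase h)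
    have := hmax (insert a (S.erase b)) (Finset.mem_powersetCard.2 ⟨Finset.subset_univ _, by
      rw [Finset.card_insert_of_notMem ha', Finset.card_erase_of_mem hb]; omega⟩)
    rw [Finset.sum_insert ha', ← Finset.add_sum_erase S g hb] at this
    linarith
  have h1 : ∑ a, p a * g a = ∑ a, p a * (g a - g b) + g b := by
    simp_rw [mul_sub]
    rw [Finset.sum_sub_distrib, ← Finset.sum_mul, hp.2]; ring
  have h2 : ∑ a, p a * (g a - g b) ≤ ∑ a ∈ S, (K : ℝ)⁻¹ * (g a - g b) := by
    rw [← Finset.sum_add_sum_compl S]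
    have h3 : ∑ a ∈ Sᶜ, p a * (g a - g b) ≤ 0 := by
      apply Finset.sum_nonpos
      intro a ha
      have := hout a (Finset.mem_compl.1 ha)
      nlinarith [hp.1 a]
    have h4 : ∑ a ∈ S, p a * (g a - g b) ≤ ∑ a ∈ S, (K : ℝ)⁻¹ * (g a - g b) := by
      apply Finset.sum_le_sum
      intro a ha
      exact mul_le_mul_of_nonneg_right (hpK a) (by linarith [hbmin a ha])
    linarith
  have h5 : ∑ a ∈ S, (K : ℝ)⁻¹ * (g a - g b) = (K : ℝ)⁻¹ * ∑ a ∈ S, g a - g b := by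
    rw [← Finset.mul_sum, Finset.sum_sub_distrib]
    simp [hSc]
    field_simp
  linarith

lemma bilin_bound {X Y : Type*} [Fintype X] [Fintype Y] [DecidableEq X] [DecidableEq Y]
    (pX : X → ℝ) (pY : Y → ℝ) (h : X → Y → ℝ) (K L : ℕ) (hK : 0 < K) (hL : 0 < L)
    (hpX : IsProb pX) (hpY : IsProb pY)
    (hX : ∀ a, pX a ≤ (K : ℝ)⁻¹) (hY : ∀ a, pY a ≤ (L : ℝ)⁻¹) (ε : ℝ)
    (hb : ∀ (S : Finset X) (T : Finset Y), S.card = K → T.card = L →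
      ∑ ω ∈ S ×ˢ T, h ω.1 ω.2 ≤ ε * (K * L)) :
    ∑ x, ∑ y, pX x * pY y * h x y ≤ ε := by
  obtain ⟨S, hS, h1⟩ := flat_bound pX (fun x => ∑ y, pY y * h x y) K hK hpX hX
  obtain ⟨T, hT, h2⟩ := flat_bound pY (fun y => ∑ x ∈ S, h x y) L hL hpY hY
  have h3 := hb S T hS hT
  have hK' : (0 : ℝ) < K := by exact_mod_cast hK
  have hL' : (0 : ℝ) < L := by exact_mod_cast hL
  have e1 : ∑ x, ∑ y, pX x * pY y * h x y = ∑ x, pX x * ∑ y, pY y * h x y := by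
    simp_rw [Finset.mul_sum, mul_assoc]
  have e2 : ∑ x ∈ S, ∑ y, pY y * h x y = ∑ y, pY y * ∑ x ∈ S, h x y := by
    rw [Finset.sum_comm]; simp_rw [Finset.mul_sum]
  have e3 : ∑ ω ∈ S ×ˢ T, h ω.1 ω.2 = ∑ y ∈ T, ∑ x ∈ S, h x y := by
    rw [Finset.sum_product, Finset.sum_comm]
  rw [e1]
  rw [e2] at h1
  rw [e3] at h3
  calc _ ≤ _ := h1
    _ ≤ (K : ℝ)⁻¹ * ((L : ℝ)⁻¹ * (ε * (K * L))) := by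
      gcongr
      exact h2.trans (by gcongr)
    _ = ε := by field_simp

/-- abstract existence -/
lemma exists_ext {X Y V : Type*} [Fintype X] [Fintype Y] [DecidableEq X] [DecidableEq Y]
    [Fintype V] [DecidableEq V] [Nonempty V] (K L : ℕ) (ε : ℝ) (h0 : 0 ≤ ε) (h1 : ε ≤ 1)
    (hJ : ((Fintype.card X ^ K * (Fintype.card Y ^ L * (2 ^ Fintype.card V) ^ L) +
      Fintype.card X ^ K * (Fintype.card Y ^ L * (2 ^ Fintype.card V) ^ K) : ℕ) : ℝ) *
        Real.exp (-(ε ^ 2 * (K * L) / 4)) < 1) :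
    ∃ f : X → Y → V, ∀ (S : Finset X) (T : Finset Y), S.card = K → T.card = L →
      (∀ A : Y → Finset V, ∑ ω ∈ S ×ˢ T, hh (A ω.2) (f ω.1 ω.2) ≤ ε * (K * L)) ∧
      (∀ A : X → Finset V, ∑ ω ∈ S ×ˢ T, hh (A ω.1) (f ω.1 ω.2) ≤ ε * (K * L)) := by
  classical
  let J := ((Fin K → X) × (Fin L → Y) × (Fin L → Finset V)) ⊕
    ((Fin K → X) × (Fin L → Y) × (Fin K → Finset V))
  let P : J → Finset (X × Y) := Sum.elim
    (fun j => Finset.univ.image j.1 ×ˢ Finset.univ.image j.2.1)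
    (fun j => Finset.univ.image j.1 ×ˢ Finset.univ.image j.2.1)
  let A : J → X × Y → Finset V := Sum.elim
    (fun j ω => Function.extend j.2.1 j.2.2 (fun _ => ∅) ω.2)
    (fun j ω => Function.extend j.1 j.2.2 (fun _ => ∅) ω.1)
  have hc : ∀ (σ : Fin K → X) (τ : Fin L → Y),
      (((Finset.univ.image σ ×ˢ Finset.univ.image τ).card : ℕ) : ℝ) ≤ K * L := by
    intro σ τ
    rw [Finset.card_product, Nat.cast_mul]
    gcongr
    · exact Finset.card_image_le.trans (by simp)
    · exact Finset.card_image_le.trans (by simp)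
  obtain ⟨f, hf⟩ := exists_good P A (K * L) (by rintro (j | j) <;> exact hc _ _) ε h0 h1 (by
    simpa [J] using hJ)
  refine ⟨fun x y => f (x, y), fun S T hS hT => ?_⟩
  obtain ⟨σ, hσi, hσ⟩ : ∃ σ : Fin K → X, Function.Injective σ ∧ Finset.univ.image σ = S := by
    let e := (Finset.equivFinOfCardEq hS).symm
    refine ⟨fun i => (e i : X), fun i j h => e.injective (Subtype.ext h), ?_⟩
    ext x
    simp only [Finset.mem_image, Finset.mem_univ, true_and]
    constructor
    · rintro ⟨i, rfl⟩; exact (e i).2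
    · intro hx; exact ⟨e.symm ⟨x, hx⟩, by simp⟩
  obtain ⟨τ, hτi, hτ⟩ : ∃ τ : Fin L → Y, Function.Injective τ ∧ Finset.univ.image τ = T := by
    let e := (Finset.equivFinOfCardEq hT).symm
    refine ⟨fun i => (e i : Y), fun i j h => e.injective (Subtype.ext h), ?_⟩
    ext x
    simp only [Finset.mem_image, Finset.mem_univ, true_and]
    constructor
    · rintro ⟨i, rfl⟩; exact (e i).2
    · intro hx; exact ⟨e.symm ⟨x, hx⟩, by simp⟩
  constructor
  · intro B
    have := hf (Sum.inl (σ, τ, B ∘ τ))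
    simp only [P, A, Sum.elim_inl, hσ, hτ] at this
    refine le_of_eq_of_le (Finset.sum_congr rfl ?_) this
    rintro ⟨x, y⟩ hω
    obtain ⟨i, -, rfl⟩ := Finset.mem_image.1 (hτ ▸ (Finset.mem_product.1 hω).2)
    simp [hτi.extend_apply]
  · intro B
    have := hf (Sum.inr (σ, τ, B ∘ σ))
    simp only [P, A, Sum.elim_inr, hσ, hτ] at this
    refine le_of_eq_of_le (Finset.sum_congr rfl ?_) this
    rintro ⟨x, y⟩ hω
    obtain ⟨i, -, rfl⟩ := Finset.mem_image.1 (hσ ▸ (Finset.mem_product.1 hω).1)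
    simp [hσi.extend_apply]

lemma sum_fiber {V Y : Type*} [Fintype V] [Fintype Y] [DecidableEq V] [DecidableEq Y]
    (T : Finset (V × Y)) (g : V × Y → ℝ) :
    ∑ z ∈ T, g z = ∑ y, ∑ v, if v ∈ Finset.univ.filter (fun v => (v, y) ∈ T) then g (v, y)
      else 0 := by
  rw [Finset.sum_comm, ← Fintype.sum_prod_type' (fun v y =>
    if v ∈ Finset.univ.filter (fun v => (v, y) ∈ T) then g (v, y) else 0)]
  simp [Finset.sum_ite_mem]

/-- The test identity: statistical test in terms of `hh`. -/
lemma test_eq {X Y V : Type*} [Fintype X] [Fintype Y] [DecidableEq Y]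
    [Fintype V] [DecidableEq V] (f : X → Y → V) (pX : X → ℝ) (pY : Y → ℝ) (hpX : ∑ x, pX x = 1)
    (T : Finset (V × Y)) :
    (∑ z ∈ T, ∑ x, if f x z.2 = z.1 then pX x * pY z.2 else 0) -
      ∑ z ∈ T, unif V z.1 * pY z.2 =
    ∑ x, ∑ y, pX x * pY y *
      hh (Finset.univ.filter (fun v => (v, y) ∈ T)) (f x y) := by
  rw [sum_fiber, sum_fiber, ← Finset.sum_sub_distrib]
  rw [Finset.sum_comm (s := (Finset.univ : Finset X))]
  refine Finset.sum_congr rfl fun y _ => ?_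
  set B := Finset.univ.filter (fun v => (v, y) ∈ T) with hB
  have e1 : (∑ v, if v ∈ B then (∑ x, if f x y = v then pX x * pY y else 0) else 0)
      = ∑ x, if f x y ∈ B then pX x * pY y else 0 := by
    rw [Finset.sum_ite_mem, Finset.univ_inter, Finset.sum_comm]
    simp
  have e2 : (∑ v, if v ∈ B then unif V v * pY y else 0) = (B.card : ℝ) / Fintype.card V * pY y := by
    rw [Finset.sum_ite_mem, Finset.univ_inter]
    simp [unif]; ring
  simp only at e1 e2 ⊢
  rw [e1, e2]
  have e3 : (B.card : ℝ) / Fintype.card V * pY y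
      = ∑ x, pX x * pY y * ((B.card : ℝ) / Fintype.card V) := by
    rw [← Finset.sum_mul, ← Finset.sum_mul, hpX]; ring
  rw [e3, ← Finset.sum_sub_distrib]
  refine Finset.sum_congr rfl fun x _ => ?_
  unfold hh
  split_ifs <;> ring

lemma statDist_le {X Y V : Type*} [Fintype X] [Fintype Y] [DecidableEq Y]
    [Fintype V] [DecidableEq V] [Nonempty V] (f : X → Y → V) (pX : X → ℝ) (pY : Y → ℝ)
    (hpX : ∑ x, pX x = 1) (ε : ℝ)
    (hb : ∀ A : Y → Finset V, ∑ x, ∑ y, pX x * pY y * hh (A y) (f x y) ≤ ε) :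
    statDist (fun z : V × Y => ∑ x, if f x z.2 = z.1 then pX x * pY z.2 else 0)
      (fun z => unif V z.1 * pY z.2) ≤ ε := by
  unfold statDist
  apply ciSup_le
  intro T
  rw [test_eq f pX pY hpX T, abs_le]
  refine ⟨?_, hb _⟩
  have := hb (fun y => (Finset.univ.filter (fun v => (v, y) ∈ T))ᶜ)
  simp_rw [hh_compl, mul_neg, Finset.sum_neg_distrib] at this
  linarith

lemma numeric (n k : ℕ) (hn : (1024 : ℝ) ≤ n) (hk : Real.logb 2 n ^ (12 : ℕ) / 2 ≤ (k : ℝ)) :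
    (((2 ^ n) ^ (4 ^ k) * ((2 ^ n * 2 ^ n) ^ (16 ^ k) * (2 ^ (2 ^ (9 * k / 5))) ^ (16 ^ k)) +
      (2 ^ n) ^ (4 ^ k) * ((2 ^ n * 2 ^ n) ^ (16 ^ k) * (2 ^ (2 ^ (9 * k / 5))) ^ (4 ^ k)) : ℕ) : ℝ)
      * Real.exp (-(((2 : ℝ) ^ (-(k : ℝ) ^ (1 / 2 : ℝ))) ^ 2 *
        (((4 ^ k : ℕ) : ℝ) * ((16 ^ k : ℕ) : ℝ)) / 4)) < 1 := by
  have hnpos : (0 : ℝ) < n := by linarith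
  have hl : (10 : ℝ) ≤ Real.logb 2 n := by
    rw [Real.le_logb_iff_rpow_le (by norm_num) hnpos]
    refine le_trans (le_of_eq ?_) hn
    rw [show (10 : ℝ) = ((10 : ℕ) : ℝ) by norm_num, Real.rpow_natCast]; norm_num
  have hlk : Real.logb 2 n ≤ k := by
    refine le_trans ?_ hk
    have : (10 : ℝ) ^ 11 ≤ Real.logb 2 n ^ 11 := by gcongr
    rw [pow_succ]
    nlinarith
  have hk4 : (10000 : ℝ) ≤ k := by
    refine le_trans ?_ hk
    have : (10 : ℝ) ^ 12 ≤ Real.logb 2 n ^ 12 := by gcongr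
    linarith
  have hn2 : n ≤ 2 ^ k := by
    have := (Real.logb_le_iff_le_rpow (by norm_num) hnpos).1 hlk
    rw [Real.rpow_natCast] at this
    exact_mod_cast this
  set m := 9 * k / 5 with hm
  have hnm : n ≤ 2 ^ m := hn2.trans (Nat.pow_le_pow_right (by norm_num) (by omega))
  have h416 : 4 ^ k ≤ 16 ^ k := Nat.pow_le_pow_left (by norm_num) k
  -- the index count
  have hcount : (2 ^ n) ^ (4 ^ k) * ((2 ^ n * 2 ^ n) ^ (16 ^ k) * (2 ^ (2 ^ m)) ^ (16 ^ k)) +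
      (2 ^ n) ^ (4 ^ k) * ((2 ^ n * 2 ^ n) ^ (16 ^ k) * (2 ^ (2 ^ m)) ^ (4 ^ k))
      ≤ 2 ^ (5 * 2 ^ m * 16 ^ k) := by
    have a1 : (2 ^ n) ^ (4 ^ k) * ((2 ^ n * 2 ^ n) ^ (16 ^ k) * (2 ^ (2 ^ m)) ^ (4 ^ k)) ≤
        (2 ^ n) ^ (4 ^ k) * ((2 ^ n * 2 ^ n) ^ (16 ^ k) * (2 ^ (2 ^ m)) ^ (16 ^ k)) := by
      gcongr
      exact Nat.one_le_two_pow
    have a2 : (2 ^ n) ^ (4 ^ k) * ((2 ^ n * 2 ^ n) ^ (16 ^ k) * (2 ^ (2 ^ m)) ^ (16 ^ k))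
        = 2 ^ (n * 4 ^ k + ((n + n) * 16 ^ k + 2 ^ m * 16 ^ k)) := by
      simp only [← pow_add, ← pow_mul]
    have a3 : n * 4 ^ k + ((n + n) * 16 ^ k + 2 ^ m * 16 ^ k) + 1 ≤ 5 * 2 ^ m * 16 ^ k := by
      have b1 : n * 4 ^ k ≤ 2 ^ m * 16 ^ k := Nat.mul_le_mul hnm h416
      have b2 : n * 16 ^ k ≤ 2 ^ m * 16 ^ k := Nat.mul_le_mul_right _ hnm
      have b3 : 1 ≤ 2 ^ m * 16 ^ k := Nat.one_le_iff_ne_zero.2 (by positivity)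
      nlinarith
    calc _ ≤ 2 ^ (n * 4 ^ k + ((n + n) * 16 ^ k + 2 ^ m * 16 ^ k)) +
          2 ^ (n * 4 ^ k + ((n + n) * 16 ^ k + 2 ^ m * 16 ^ k)) := by
          rw [← a2]; exact Nat.add_le_add_left a1 _
      _ = 2 ^ (n * 4 ^ k + ((n + n) * 16 ^ k + 2 ^ m * 16 ^ k) + 1) := by rw [pow_succ]; ring
      _ ≤ _ := Nat.pow_le_pow_right (by norm_num) a3
  have hcount' : ((2 ^ (5 * 2 ^ m * 16 ^ k) : ℕ) : ℝ) ≤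
      Real.exp (5 * 2 ^ m * 16 ^ k) := by
    push_cast
    have : (2 : ℝ) ≤ Real.exp 1 := by linarith [Real.add_one_le_exp (1 : ℝ)]
    calc (2 : ℝ) ^ (5 * 2 ^ m * 16 ^ k) ≤ Real.exp 1 ^ (5 * 2 ^ m * 16 ^ k) := by gcongr
      _ = _ := by rw [← Real.exp_nat_mul]; push_cast; simp
  -- exponent comparison
  have hexp : (5 * 2 ^ m * 16 ^ k : ℝ) <
      ((2 : ℝ) ^ (-(k : ℝ) ^ (1 / 2 : ℝ))) ^ 2 * (((4 ^ k : ℕ) : ℝ) * ((16 ^ k : ℕ) : ℝ)) / 4 := by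
    have hr : (k : ℝ) ^ (1 / 2 : ℝ) = √k := (Real.sqrt_eq_rpow _).symm
    have hs1 : (100 : ℝ) ≤ √k := Real.le_sqrt_of_sq_le (by linarith)
    have hs2 : √k * √k = k := Real.mul_self_sqrt (by positivity)
    have hmr : (m : ℝ) ≤ 9 * k / 5 := by
      have : 5 * m ≤ 9 * k := by omega
      have : (5 * m : ℝ) ≤ 9 * k := by exact_mod_cast this
      linarith
    have key : (2 : ℝ) ^ (5 + m : ℝ) < 2 ^ (-√k * 2 + 2 * k) := by
      apply Real.rpow_lt_rpow_of_exponent_lt (by norm_num)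
      nlinarith
    rw [Real.rpow_add (by norm_num), Real.rpow_add (by norm_num), Real.rpow_natCast,
      Real.rpow_mul (by norm_num), Real.rpow_mul (by norm_num), Real.rpow_natCast] at key
    rw [hr]
    push_cast
    have e1 : ((2 : ℝ) ^ (-√k)) ^ (2 : ℝ) = ((2 : ℝ) ^ (-√k)) ^ 2 := Real.rpow_two _
    have e2 : ((2 : ℝ) ^ (2 : ℝ)) = 4 := by rw [Real.rpow_two]; norm_num
    have e3 : ((2 : ℝ) ^ (5 : ℝ)) = 32 := by
      rw [show (5 : ℝ) = ((5 : ℕ) : ℝ) by norm_num, Real.rpow_natCast]; norm_num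
    rw [e1, e2, e3] at key
    have h16 : (0 : ℝ) < 16 ^ k := by positivity
    have h2m : (0 : ℝ) < 2 ^ m := by positivity
    have : 5 * (2 : ℝ) ^ m < ((2 : ℝ) ^ (-√k)) ^ 2 * 4 ^ k / 4 := by linarith
    calc _ < ((2 : ℝ) ^ (-√k)) ^ 2 * 4 ^ k / 4 * 16 ^ k := by gcongr
      _ = _ := by ring
  calc _ ≤ Real.exp (5 * 2 ^ m * 16 ^ k) * Real.exp _ := by
        apply mul_le_mul_of_nonneg_right _ (Real.exp_pos _).le
        exact le_trans (by exact_mod_cast hcount) hcount'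
    _ < 1 := by
        rw [← Real.exp_add, Real.exp_lt_one_iff]
        linarith

/-- There are constants `C₀ > 1` and `c > 0` such that for all `n ≥ C₀`
and `k ≥ (1/2)(log₂ n)^12` there is a function `IExt : {0,1}ⁿ × {0,1}^{2n} → {0,1}^m`,
`m = ⌊1.8k⌋`, such that for every `(n,2k)`-source `X` and every independent `(2k,2k)`
block source `Y = (Y₁, Y₂)` on `{0,1}ⁿ × {0,1}ⁿ`, `|(IExt(X,Y), Y) − (U_m, Y)| ≤ ε`
and `|(IExt(X,Y), X) − (U_m, X)| ≤ ε` where `ε = 2^{−k^c}`. -/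
theorem main_extractor_theorem :
    ∃ C₀ c : ℝ, 1 < C₀ ∧ 0 < c ∧
      ∀ n k : ℕ, C₀ ≤ (n : ℝ) → Real.logb 2 n ^ (12 : ℕ) / 2 ≤ (k : ℝ) →
        ∃ IExt : BitStr n → BitStr n × BitStr n → BitStr (9 * k / 5),
          ∀ (pX : BitStr n → ℝ) (pY : BitStr n × BitStr n → ℝ),
            IsProb pX → IsProb pY → IsKSource pX (2 * k : ℝ) →
            IsBlockSource2 pY (2 * k : ℝ) (2 * k : ℝ) →
            statDist
                (fun z : BitStr (9 * k / 5) × (BitStr n × BitStr n) =>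
                  ∑ x : BitStr n, if IExt x z.2 = z.1 then pX x * pY z.2 else 0)
                (fun z => unif (BitStr (9 * k / 5)) z.1 * pY z.2)
              ≤ (2 : ℝ) ^ (-(k : ℝ) ^ c) ∧
            statDist
                (fun z : BitStr (9 * k / 5) × BitStr n =>
                  ∑ y : BitStr n × BitStr n, if IExt z.2 y = z.1 then pX z.2 * pY y else 0)
                (fun z => unif (BitStr (9 * k / 5)) z.1 * pX z.2)
              ≤ (2 : ℝ) ^ (-(k : ℝ) ^ c) := by
  refine ⟨1024, 1 / 2, by norm_num, by norm_num, ?_⟩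
  intro n k hn hk
  have hε1 : (2 : ℝ) ^ (-(k : ℝ) ^ (1 / 2 : ℝ)) ≤ 1 :=
    Real.rpow_le_one_of_one_le_of_nonpos (by norm_num) (by
      have : (0 : ℝ) ≤ (k : ℝ) ^ (1 / 2 : ℝ) := by positivity
      linarith)
  obtain ⟨f, hf⟩ := exists_ext (X := BitStr n) (Y := BitStr n × BitStr n)
    (V := BitStr (9 * k / 5)) (4 ^ k) (16 ^ k) ((2 : ℝ) ^ (-(k : ℝ) ^ (1 / 2 : ℝ)))
    (by positivity) hε1 (by
      have := numeric n k hn hk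
      have c1 : ∀ a, Fintype.card (BitStr a) = 2 ^ a := fun a => by simp
      rw [Fintype.card_prod, c1, c1]
      exact this)
  refine ⟨f, fun pX pY hpX hpY hX hY => ?_⟩
  have h2 : (2 : ℝ) ^ (-(2 * k : ℝ)) = ((4 ^ k : ℕ) : ℝ)⁻¹ := by
    rw [Real.rpow_neg (by norm_num), Real.rpow_mul (by norm_num), Real.rpow_natCast]
    norm_num
  have hX' : ∀ a, pX a ≤ ((4 ^ k : ℕ) : ℝ)⁻¹ := fun a => h2 ▸ hX a
  have hY' : ∀ a, pY a ≤ ((16 ^ k : ℕ) : ℝ)⁻¹ := by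
    rintro ⟨y₁, y₂⟩
    by_cases h : ∑ y₂, pY (y₁, y₂) = 0
    · have := Finset.single_le_sum (f := fun y₂ => pY (y₁, y₂)) (fun i _ => hpY.1 _)
        (Finset.mem_univ y₂)
      simp only [h] at this
      exact this.trans (by positivity)
    · have a1 := hY.2 y₁ h y₂
      have a2 := hY.1 y₁
      rw [h2] at a1 a2
      have e : ((16 ^ k : ℕ) : ℝ)⁻¹ = ((4 ^ k : ℕ) : ℝ)⁻¹ * ((4 ^ k : ℕ) : ℝ)⁻¹ := by
        rw [← mul_inv, ← Nat.cast_mul, ← mul_pow]; norm_num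
      rw [e]
      exact a1.trans (by gcongr)
  constructor
  · apply statDist_le f pX pY hpX.2
    intro A
    exact bilin_bound pX pY (fun x y => hh (A y) (f x y)) (4 ^ k) (16 ^ k) (by positivity)
      (by positivity) hpX hpY hX' hY' _ (fun S T hS hT => (hf S T hS hT).1 A)
  · have := statDist_le (fun y x => f x y) pY pX hpY.2 ((2 : ℝ) ^ (-(k : ℝ) ^ (1 / 2 : ℝ))) (by
      intro A
      have := bilin_bound pX pY (fun x y => hh (A x) (f x y)) (4 ^ k) (16 ^ k) (by positivity)
        (by positivity) hpX hpY hX' hY' _ (fun S T hS hT => (hf S T hS hT).2 A)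
      rw [Finset.sum_comm]
      simp_rw [mul_comm (pY _) (pX _)]
      exact this)
    simp_rw [mul_comm (pY _) (pX _)] at this
    exact this
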